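/- Let μ be a finite positive Borel measure on the unit circle ∂𝔻 and let σ > −1. There exists a constant C > 0, depending only on σ, such that for every analytic function f on 𝔻, ∫_𝔻 ∫_𝔻 |f(z)−f(w)|² / |1−z̄w|^{4+2σ} · P_μ(z) (1−|z|²)^σ (1−|w|²)^σ dA(z) dA(w) ≤ C ∫_𝔻 |f'(w)|² P_μ(w) dA(w). -/

import Mathlib

open MeasureTheory

noncomputable section

/-- The Poisson integral `P_μ(z) = (1/2π) ∫_{∂𝔻} (1-|z|²)/|ζ-z|² dμ(ζ)` of a measure `μ`
on the unit circle. -/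
def poissonInt (μ : Measure ℂ) (z : ℂ) : ℝ :=
  (2 * Real.pi)⁻¹ * ∫ ζ, (1 - ‖z‖ ^ 2) / ‖ζ - z‖ ^ 2 ∂μ

/-- The involutive automorphism `u ↦ (a - u) / (1 - conj a * u)` of the unit disc. -/
def discInvolution (a u : ℂ) : ℂ := (a - u) / (1 - (starRingEnd ℂ) a * u)

theorem one_sub_sq_norm_pos {u : ℂ} (hu : u ∈ Metric.ball (0:ℂ) 1) : 0 < 1 - ‖u‖ ^ 2 := by
  have : ‖u‖ < 1 := by simpa using hu
  nlinarith [norm_nonneg u]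

theorem one_sub_conj_mul_ne_zero {a u : ℂ} (ha : a ∈ Metric.ball (0:ℂ) 1)
    (hu : u ∈ Metric.ball (0:ℂ) 1) : 1 - (starRingEnd ℂ) a * u ≠ 0 := by
  have ha' : ‖a‖ < 1 := by simpa using ha
  have hu' : ‖u‖ < 1 := by simpa using hu
  intro h
  have h1 : ‖(starRingEnd ℂ) a * u‖ = 1 := by rw [← sub_eq_zero.mp h]; simp
  rw [norm_mul, RCLike.norm_conj] at h1
  nlinarith [norm_nonneg a, norm_nonneg u]

theorem one_sub_sq_norm_discInvolution {a u : ℂ} (ha : a ∈ Metric.ball (0:ℂ) 1)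
    (hu : u ∈ Metric.ball (0:ℂ) 1) :
    1 - ‖discInvolution a u‖ ^ 2 =
      (1 - ‖a‖ ^ 2) * (1 - ‖u‖ ^ 2) / ‖1 - (starRingEnd ℂ) a * u‖ ^ 2 := by
  have h := norm_ne_zero_iff.mpr (one_sub_conj_mul_ne_zero ha hu)
  rw [discInvolution, norm_div, div_pow, eq_div_iff (pow_ne_zero 2 h), sub_mul,
    div_mul_cancel₀ _ (pow_ne_zero 2 h)]
  simp only [← Complex.normSq_eq_norm_sq, Complex.normSq_apply, Complex.sub_re, Complex.sub_im,
    Complex.mul_re, Complex.mul_im, Complex.conj_re, Complex.conj_im, Complex.one_re,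
    Complex.one_im]
  ring

theorem discInvolution_mem_ball {a u : ℂ} (ha : a ∈ Metric.ball (0:ℂ) 1)
    (hu : u ∈ Metric.ball (0:ℂ) 1) : discInvolution a u ∈ Metric.ball (0:ℂ) 1 := by
  have h := norm_pos_iff.mpr (one_sub_conj_mul_ne_zero ha hu)
  have h1 : 0 < 1 - ‖discInvolution a u‖ ^ 2 := by
    rw [one_sub_sq_norm_discInvolution ha hu]
    have := one_sub_sq_norm_pos ha
    have := one_sub_sq_norm_pos hu
    positivity
  rw [mem_ball_zero_iff]
  nlinarith [norm_nonneg (discInvolution a u)]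

theorem one_sub_conj_mul_discInvolution {a u : ℂ} (ha : a ∈ Metric.ball (0:ℂ) 1)
    (hu : u ∈ Metric.ball (0:ℂ) 1) :
    1 - (starRingEnd ℂ) a * discInvolution a u =
      (1 - ‖a‖ ^ 2 : ℝ) / (1 - (starRingEnd ℂ) a * u) := by
  have h := one_sub_conj_mul_ne_zero ha hu
  rw [discInvolution, eq_div_iff h]
  have h2 : (starRingEnd ℂ) a * a = (‖a‖ : ℂ) ^ 2 := Complex.conj_mul' a
  push_cast
  field_simp
  linear_combination -h2

theorem discInvolution_discInvolution {a u : ℂ} (ha : a ∈ Metric.ball (0:ℂ) 1)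
    (hu : u ∈ Metric.ball (0:ℂ) 1) : discInvolution a (discInvolution a u) = u := by
  have h := one_sub_conj_mul_ne_zero ha hu
  have h1 := one_sub_conj_mul_ne_zero ha (discInvolution_mem_ball ha hu)
  conv_lhs => rw [discInvolution]
  rw [div_eq_iff h1, discInvolution]
  generalize (starRingEnd ℂ) a = b at *
  linear_combination -div_mul_cancel₀ (a - u) h

theorem discInvolution_image_ball {a : ℂ} (ha : a ∈ Metric.ball (0:ℂ) 1) :
    discInvolution a '' Metric.ball 0 1 = Metric.ball 0 1 := by
  ext w
  constructor
  · rintro ⟨u, hu, rfl⟩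
    exact discInvolution_mem_ball ha hu
  · exact fun hw => ⟨_, discInvolution_mem_ball ha hw, discInvolution_discInvolution ha hw⟩

theorem hasDerivAt_discInvolution {a u : ℂ} (ha : a ∈ Metric.ball (0:ℂ) 1)
    (hu : u ∈ Metric.ball (0:ℂ) 1) :
    HasDerivAt (discInvolution a)
      (-(1 - ‖a‖ ^ 2 : ℝ) / (1 - (starRingEnd ℂ) a * u) ^ 2) u := by
  have h := one_sub_conj_mul_ne_zero ha hu
  have h1 : HasDerivAt (fun u : ℂ => a - u) (-1) u := by
    simpa using (hasDerivAt_id u).const_sub a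
  have h2 : HasDerivAt (fun u : ℂ => 1 - (starRingEnd ℂ) a * u) (-(starRingEnd ℂ) a) u := by
    simpa using ((hasDerivAt_id u).const_mul ((starRingEnd ℂ) a)).const_sub 1
  refine (h1.div h2 h).congr_deriv ?_
  have h3 : (starRingEnd ℂ) a * a = (‖a‖ : ℂ) ^ 2 := Complex.conj_mul' a
  congr 1
  push_cast
  linear_combination h3

theorem det_restrictScalars_toSpanSingleton (c : ℂ) :
    ((ContinuousLinearMap.toSpanSingleton ℂ c).restrictScalars ℝ).det = ‖c‖ ^ 2 := by
  simp [ContinuousLinearMap.det, LinearMap.det_restrictScalars,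
      Algebra.norm_complex_eq, Complex.normSq_eq_norm_sq]

/-- Möbius change of variables for the weighted area measure `(1 - |u|²) ^ σ dA(u)`. -/
theorem lintegral_ball_comp_discInvolution {a : ℂ} (ha : a ∈ Metric.ball (0:ℂ) 1) (σ : ℝ)
    (F : ℂ → ENNReal) :
    ∫⁻ w in Metric.ball (0:ℂ) 1, F w * ENNReal.ofReal
        ((1 - ‖w‖ ^ 2) ^ σ * (1 - ‖a‖ ^ 2) ^ (σ + 2) /
          ‖1 - (starRingEnd ℂ) a * w‖ ^ (4 + 2 * σ)) =
      ∫⁻ u in Metric.ball (0:ℂ) 1, F (discInvolution a u) * ENNReal.ofReal ((1 - ‖u‖ ^ 2) ^ σ) := by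
  have hinj : Set.InjOn (discInvolution a) (Metric.ball 0 1) := fun u hu v hv h => by
    rw [← discInvolution_discInvolution ha hu, h, discInvolution_discInvolution ha hv]
  conv_lhs => rw [← discInvolution_image_ball ha]
  rw [lintegral_image_eq_lintegral_abs_det_fderiv_mul volume measurableSet_ball
    (fun u hu => ((hasDerivAt_discInvolution ha hu).hasFDerivAt.restrictScalars ℝ).hasFDerivWithinAt)
    hinj]
  refine setLIntegral_congr_fun measurableSet_ball fun u hu => ?_
  have hA := one_sub_sq_norm_pos ha
  have hU := one_sub_sq_norm_pos hu
  have hD := norm_pos_iff.mpr (one_sub_conj_mul_ne_zero ha hu)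
  simp only [det_restrictScalars_toSpanSingleton]
  rw [mul_left_comm, ← ENNReal.ofReal_mul (by positivity)]
  congr 2
  rw [one_sub_sq_norm_discInvolution ha hu, one_sub_conj_mul_discInvolution ha hu]
  simp only [norm_div, norm_neg, norm_pow, Complex.norm_real, Real.norm_of_nonneg hA.le,
    abs_sq]
  generalize 1 - ‖a‖ ^ 2 = A at *
  generalize 1 - ‖u‖ ^ 2 = U at *
  generalize ‖1 - (starRingEnd ℂ) a * u‖ = D at *
  have e4 : D ^ (4 + 2 * σ) = D ^ 4 * (D ^ σ) ^ 2 := by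
    rw [Real.rpow_add hD, ← Real.rpow_mul_natCast hD.le, mul_comm 2 σ]
    norm_cast
  have e5 : A ^ (4 + 2 * σ) = A ^ 4 * (A ^ σ) ^ 2 := by
    rw [Real.rpow_add hA, ← Real.rpow_mul_natCast hA.le, mul_comm 2 σ]
    norm_cast
  have e2 : A ^ (σ + 2) = A ^ σ * A ^ 2 := by
    rw [Real.rpow_add hA]
    norm_cast
  have e3 : (D ^ 2) ^ σ = (D ^ σ) ^ 2 := by
    rw [← Real.rpow_mul_natCast hD.le, ← Real.rpow_natCast_mul hD.le, mul_comm]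
  rw [Real.div_rpow (by positivity) (by positivity), Real.mul_rpow hA.le hU.le,
    Real.div_rpow hA.le hD.le, e2, e3, e4, e5]
  field_simp

/-- Polar coordinates for radially weighted integrals over the unit disc. -/
theorem lintegral_ball_mul_radial {F : ℂ → ENNReal} (hF : ContinuousOn F (Metric.ball 0 1))
    (σ : ℝ) :
    ∫⁻ u in Metric.ball (0:ℂ) 1, F u * ENNReal.ofReal ((1 - ‖u‖ ^ 2) ^ σ) =
      ∫⁻ r in Set.Ioo (0:ℝ) 1, ENNReal.ofReal (r * (1 - r ^ 2) ^ σ) *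
        ∫⁻ θ in Set.Ioo (-Real.pi) Real.pi, F (r * Complex.exp (θ * Complex.I)) := by
  set G : ℂ → ENNReal := (Metric.ball (0:ℂ) 1).indicator F with hG
  have hGm : Measurable G := by
    classical
    have := hF.measurable_piecewise (g := 0) continuousOn_const
      (measurableSet_ball (x := (0:ℂ)) (ε := 1))
    rwa [Set.piecewise_eq_indicator] at this
  have hpt : ∀ r θ : ℝ, Complex.polarCoord.symm (r, θ) = r * Complex.exp (θ * Complex.I) := by
    intro r θ
    rw [Complex.polarCoord_symm_apply, Complex.exp_mul_I]
    simp
  have hnorm : ∀ r θ : ℝ, ‖(r : ℂ) * Complex.exp (θ * Complex.I)‖ = |r| := by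
    intro r θ
    simp [Complex.norm_exp_ofReal_mul_I]
  have hm : Measurable fun p : ℝ × ℝ => ENNReal.ofReal (p.1 * (1 - p.1 ^ 2) ^ σ) *
      G (p.1 * Complex.exp (p.2 * Complex.I)) := by
    refine Measurable.mul (by fun_prop) (hGm.comp (by fun_prop))
  calc _ = ∫⁻ u, G u * ENNReal.ofReal ((1 - ‖u‖ ^ 2) ^ σ) := by
        rw [← lintegral_indicator measurableSet_ball]
        congr with u
        by_cases hu : u ∈ Metric.ball (0:ℂ) 1 <;> simp [hG, hu]
    _ = ∫⁻ p in Set.Ioi (0:ℝ) ×ˢ Set.Ioo (-Real.pi) Real.pi,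
          ENNReal.ofReal (p.1 * (1 - p.1 ^ 2) ^ σ) * G (p.1 * Complex.exp (p.2 * Complex.I)) := by
        rw [← Complex.lintegral_comp_polarCoord_symm, polarCoord_target]
        refine setLIntegral_congr_fun (measurableSet_Ioi.prod measurableSet_Ioo) ?_
        rintro ⟨r, θ⟩ ⟨hr, -⟩
        have hr : 0 < r := hr
        simp only [hpt, hnorm, sq_abs, smul_eq_mul]
        rw [ENNReal.ofReal_mul hr.le]
        ring
    _ = ∫⁻ r in Set.Ioi (0:ℝ), ∫⁻ θ in Set.Ioo (-Real.pi) Real.pi,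
          ENNReal.ofReal (r * (1 - r ^ 2) ^ σ) * G (r * Complex.exp (θ * Complex.I)) := by
        rw [Measure.volume_eq_prod, ← Measure.prod_restrict, lintegral_prod _ hm.aemeasurable]
    _ = ∫⁻ r in Set.Ioo (0:ℝ) 1, ∫⁻ θ in Set.Ioo (-Real.pi) Real.pi,
          ENNReal.ofReal (r * (1 - r ^ 2) ^ σ) * G (r * Complex.exp (θ * Complex.I)) := by
        rw [← lintegral_indicator measurableSet_Ioi, ← lintegral_indicator measurableSet_Ioo]
        congr with r
        by_cases hr : 0 < r
        · by_cases hr1 : r < 1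
          · simp [hr, hr1]
          · have : ∀ θ : ℝ, G (r * Complex.exp (θ * Complex.I)) = 0 := fun θ => by
              refine Set.indicator_of_notMem ?_ _
              rwa [mem_ball_zero_iff, hnorm, abs_of_pos hr]
            simp [hr1, this]
        · simp [hr]
    _ = _ := by
        refine setLIntegral_congr_fun measurableSet_Ioo fun r hr => ?_
        have : ∀ θ : ℝ, G (r * Complex.exp (θ * Complex.I)) = F (r * Complex.exp (θ * Complex.I)) :=
          fun θ => by
            refine Set.indicator_of_mem ?_ _
            rw [mem_ball_zero_iff, hnorm, abs_of_pos hr.1]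
            exact hr.2
        simp only [this]
        exact lintegral_const_mul' _ _ ENNReal.ofReal_ne_top

theorem hasDerivAt_one_sub_sq_rpow {r : ℝ} (hr : r ∈ Set.Ioo (0:ℝ) 1) (b : ℝ) :
    HasDerivAt (fun r : ℝ => (1 - r ^ 2) ^ (b + 1)) (-(2 * (b + 1)) * (r * (1 - r ^ 2) ^ b)) r := by
  have h0 : 0 < 1 - r ^ 2 := by nlinarith [hr.1, hr.2]
  have h1 : HasDerivAt (fun r : ℝ => 1 - r ^ 2) (-(2 * r)) r := by
    simpa using (hasDerivAt_pow 2 r).const_sub 1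
  refine (h1.rpow_const (p := b + 1) (Or.inl h0.ne')).congr_deriv ?_
  rw [add_sub_cancel_right]
  ring

theorem continuous_one_sub_sq_rpow {b : ℝ} (hb : 0 ≤ b) :
    Continuous fun r : ℝ => (1 - r ^ 2) ^ b :=
  (by fun_prop : Continuous fun r : ℝ => 1 - r ^ 2).rpow_const fun _ => Or.inr hb

theorem intervalIntegrable_mul_one_sub_sq_rpow {b : ℝ} (hb : -1 < b) :
    IntervalIntegrable (fun r : ℝ => r * (1 - r ^ 2) ^ b) volume 0 1 := by
  have h := intervalIntegral.intervalIntegrable_deriv_of_nonneg (a := 0) (b := 1)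
    (g := fun r : ℝ => -(1 - r ^ 2) ^ (b + 1)) (g' := fun r => 2 * (b + 1) * (r * (1 - r ^ 2) ^ b))
    (continuous_one_sub_sq_rpow (by linarith)).neg.continuousOn
    (fun r hr => by
      rw [min_eq_left zero_le_one, max_eq_right zero_le_one] at hr
      exact (hasDerivAt_one_sub_sq_rpow hr b).neg.congr_deriv (by ring))
    (fun r hr => by
      rw [min_eq_left zero_le_one, max_eq_right zero_le_one] at hr
      have h0 : 0 < 1 - r ^ 2 := by nlinarith [hr.1, hr.2]
      have := hr.1
      have : 0 < b + 1 := by linarith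
      positivity)
  have hb' : b + 1 ≠ 0 := by linarith
  convert h.const_mul (2 * (b + 1))⁻¹ using 2 with r
  field_simp

theorem intervalIntegrable_pow_mul_one_sub_sq_rpow {b : ℝ} (hb : -1 < b) (n : ℕ) :
    IntervalIntegrable (fun r : ℝ => r ^ (n + 1) * (1 - r ^ 2) ^ b) volume 0 1 := by
  convert (intervalIntegrable_mul_one_sub_sq_rpow hb).continuousOn_mul
    (continuous_pow n).continuousOn using 2 with r
  ring

theorem integral_mul_one_sub_sq_rpow {b : ℝ} (hb : -1 < b) :
    ∫ r in (0:ℝ)..1, r * (1 - r ^ 2) ^ b = (2 * (b + 1))⁻¹ := by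
  have hb' : 2 * (b + 1) ≠ 0 := by linarith
  have h := intervalIntegral.integral_eq_sub_of_hasDerivAt_of_le zero_le_one
    (continuous_one_sub_sq_rpow (b := b + 1) (by linarith)).continuousOn
    (fun r hr => hasDerivAt_one_sub_sq_rpow hr b)
    ((intervalIntegrable_mul_one_sub_sq_rpow hb).const_mul _)
  rw [intervalIntegral.integral_const_mul] at h
  have h0 : (0:ℝ) ^ (b + 1) = 0 := Real.zero_rpow (by linarith)
  norm_num [h0] at h
  exact eq_inv_of_mul_eq_one_right h

/-- Integration by parts for Beta-type integrals. -/
theorem integral_pow_add_three_mul_one_sub_sq_rpow {b : ℝ} (hb : -1 < b) (n : ℕ) :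
    (b + 1) * ∫ r in (0:ℝ)..1, r ^ (2 * n + 3) * (1 - r ^ 2) ^ b =
      (n + 1) * ∫ r in (0:ℝ)..1, r ^ (2 * n + 1) * (1 - r ^ 2) ^ (b + 1) := by
  have i1 := (intervalIntegrable_pow_mul_one_sub_sq_rpow hb (2 * n + 2)).const_mul (2 * (b + 1))
  have i2 := (intervalIntegrable_pow_mul_one_sub_sq_rpow (b := b + 1) (by linarith)
    (2 * n)).const_mul (2 * (n + 1) : ℝ)
  have h := intervalIntegral.integral_eq_sub_of_hasDerivAt_of_le
    (f := fun r : ℝ => r ^ (2 * n + 2) * (1 - r ^ 2) ^ (b + 1)) zero_le_one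
    ((continuous_pow _).mul (continuous_one_sub_sq_rpow (by linarith))).continuousOn
    (fun r hr => ((hasDerivAt_pow (2 * n + 2) r).mul
      (hasDerivAt_one_sub_sq_rpow hr b)).congr_deriv (g' := 2 * (n + 1) *
        (r ^ (2 * n + 1) * (1 - r ^ 2) ^ (b + 1)) -
          2 * (b + 1) * (r ^ (2 * n + 2 + 1) * (1 - r ^ 2) ^ b)) (by
        push_cast
        ring))
    (i2.sub i1)
  rw [intervalIntegral.integral_sub i2 i1, intervalIntegral.integral_const_mul,
    intervalIntegral.integral_const_mul] at h
  have h0 : (0:ℝ) ^ (b + 1) = 0 := Real.zero_rpow (by linarith)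
  norm_num [h0] at h
  linarith

theorem integral_pow_add_three_mul_one_sub_sq_rpow_le {σ : ℝ} (hσ : -1 < σ) (n : ℕ) :
    ∫ r in (0:ℝ)..1, r ^ (2 * n + 3) * (1 - r ^ 2) ^ σ ≤
      (σ + 3) / ((σ + 1) * (σ + 2)) *
        ((n + 1) ^ 2 * ∫ r in (0:ℝ)..1, r ^ (2 * n + 1) * (1 - r ^ 2) ^ (σ + 2)) := by
  have h1 := integral_pow_add_three_mul_one_sub_sq_rpow hσ n
  have h2 := integral_pow_add_three_mul_one_sub_sq_rpow (b := σ + 1) (by linarith) n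
  rw [show σ + 1 + 1 = σ + 2 by ring] at h2
  have h3 : ∫ r in (0:ℝ)..1, r ^ (2 * n + 1) * (1 - r ^ 2) ^ (σ + 1) =
      (∫ r in (0:ℝ)..1, r ^ (2 * n + 1) * (1 - r ^ 2) ^ (σ + 2)) +
        ∫ r in (0:ℝ)..1, r ^ (2 * n + 3) * (1 - r ^ 2) ^ (σ + 1) := by
    rw [← intervalIntegral.integral_add
      (intervalIntegrable_pow_mul_one_sub_sq_rpow (by linarith) _)
      (intervalIntegrable_pow_mul_one_sub_sq_rpow (by linarith) _)]
    refine intervalIntegral.integral_congr fun r hr => ?_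
    rw [Set.uIcc_of_le zero_le_one] at hr
    have h0 : 0 ≤ 1 - r ^ 2 := by nlinarith [hr.1, hr.2]
    have h2 : (1 - r ^ 2) ^ (σ + 2) = (1 - r ^ 2) ^ (σ + 1) * (1 - r ^ 2) := by
      rw [← Real.rpow_add_one' h0 (by linarith), add_assoc, one_add_one_eq_two]
    rw [h2]
    ring
  have hJ : 0 ≤ ∫ r in (0:ℝ)..1, r ^ (2 * n + 1) * (1 - r ^ 2) ^ (σ + 2) := by
    refine intervalIntegral.integral_nonneg zero_le_one fun r hr => ?_
    have h0 : 0 ≤ 1 - r ^ 2 := by nlinarith [hr.1, hr.2]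
    have := hr.1
    positivity
  generalize (∫ r in (0:ℝ)..1, r ^ (2 * n + 1) * (1 - r ^ 2) ^ (σ + 2)) = J at *
  generalize (∫ r in (0:ℝ)..1, r ^ (2 * n + 3) * (1 - r ^ 2) ^ (σ + 1)) = K at *
  generalize (∫ r in (0:ℝ)..1, r ^ (2 * n + 3) * (1 - r ^ 2) ^ σ) = I at *
  have s1 : 0 < σ + 1 := by linarith
  have s2 : 0 < σ + 2 := by linarith
  have hI : I = (n + 1) * (σ + 3 + n) / ((σ + 1) * (σ + 2)) * J := by
    rw [h3] at h1
    field_simp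
    linear_combination (σ + 2) * h1 + (n + 1 : ℝ) * h2
  have hn : (0:ℝ) ≤ n := n.cast_nonneg
  rw [hI, div_mul_eq_mul_div, div_mul_eq_mul_div]
  refine div_le_div_of_nonneg_right ?_ (by positivity)
  have : (σ + 3 + n) ≤ (n + 1) * (σ + 3) := by nlinarith
  calc _ ≤ (n + 1) * ((n + 1) * (σ + 3)) * J := by gcongr
    _ = _ := by ring

theorem lintegral_Ioo_eq_ofReal_integral {φ : ℝ → ℝ} {a b : ℝ} (hab : a ≤ b)
    (hφ : IntervalIntegrable φ volume a b) (h0 : ∀ r ∈ Set.Ioo a b, 0 ≤ φ r) :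
    ∫⁻ r in Set.Ioo a b, ENNReal.ofReal (φ r) = ENNReal.ofReal (∫ r in a..b, φ r) := by
  rw [intervalIntegral.integral_of_le hab, integral_Ioc_eq_integral_Ioo,
    ofReal_integral_eq_lintegral_ofReal]
  · exact (intervalIntegrable_iff_integrableOn_Ioo_of_le hab).mp hφ
  · exact (ae_restrict_iff' measurableSet_Ioo).mpr (ae_of_all _ h0)

theorem integral_exp_intCast_mul_I (k : ℤ) :
    ∫ θ in (-Real.pi)..Real.pi, Complex.exp (k * (θ * Complex.I)) =
      if k = 0 then (2 * Real.pi : ℂ) else 0 := by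
  split_ifs with hk
  · simp [hk]
    ring
  · have hc : (k * Complex.I : ℂ) ≠ 0 := by simp [hk]
    have h := integral_exp_mul_complex (a := -Real.pi) (b := Real.pi) hc
    simp only [show ∀ θ : ℝ, (k * (θ * Complex.I) : ℂ) = k * Complex.I * θ by intro θ; ring]
    rw [h, div_eq_zero_iff, sub_eq_zero]
    left
    rw [Complex.exp_eq_exp_iff_exists_int]
    refine ⟨k, ?_⟩
    push_cast
    ring

/-- **Parseval's identity** for absolutely convergent one-sided Fourier series. -/
theorem hasSum_integral_sq_norm {c : ℕ → ℂ} (hc : Summable fun n => ‖c n‖) {F : ℝ → ℂ}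
    (hF : ∀ θ : ℝ, HasSum (fun n : ℕ => c n * Complex.exp (θ * Complex.I) ^ n) (F θ)) :
    HasSum (fun n => 2 * Real.pi * ‖c n‖ ^ 2) (∫ θ in (-Real.pi)..Real.pi, ‖F θ‖ ^ 2) := by
  set e : ℕ → ℝ → ℂ := fun n θ => Complex.exp (θ * Complex.I) ^ n with he
  have hen : ∀ n θ, ‖e n θ‖ = 1 := fun n θ => by simp [he, Complex.norm_exp_ofReal_mul_I]
  have hec : ∀ n, Continuous (e n) := fun n => by simp only [he]; fun_prop
  have hbd : ∀ n θ, ‖c n * e n θ‖ ≤ ‖c n‖ := fun n θ => by simp [hen]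
  have hFt : F = fun θ => ∑' n, c n * e n θ := funext fun θ => (hF θ).tsum_eq.symm
  have hFc : Continuous F := by
    rw [hFt]
    exact continuous_tsum (fun n => continuous_const.mul (hec n)) hc hbd
  have hFb : ∀ θ, ‖F θ‖ ≤ ∑' n, ‖c n‖ := fun θ => by
    rw [hFt]
    exact tsum_of_norm_bounded hc.hasSum fun n => hbd n θ
  have horth : ∀ m n, ∫ θ in (-Real.pi)..Real.pi, (starRingEnd ℂ) (e n θ) * e m θ =
      if m = n then (2 * Real.pi : ℂ) else 0 := fun m n => by
    have h := integral_exp_intCast_mul_I ((m : ℤ) - n)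
    simp only [sub_eq_zero, Nat.cast_inj] at h
    rw [← h]
    refine intervalIntegral.integral_congr fun θ _ => ?_
    simp only [he, ← Complex.exp_nat_mul, ← Complex.exp_conj, ← Complex.exp_add]
    congr 1
    simp
    ring
  have hcoef : ∀ n, ∫ θ in (-Real.pi)..Real.pi, (starRingEnd ℂ) (e n θ) * F θ =
      2 * Real.pi * c n := fun n => by
    have h := intervalIntegral.hasSum_integral_of_dominated_convergence (μ := volume)
      (a := -Real.pi) (b := Real.pi)
      (F := fun m θ => (starRingEnd ℂ) (e n θ) * (c m * e m θ))
      (f := fun θ => (starRingEnd ℂ) (e n θ) * F θ) (fun m _ => ‖c m‖)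
      (fun m => (Continuous.aestronglyMeasurable
        ((Complex.continuous_conj.comp (hec n)).mul (continuous_const.mul (hec m)))))
      (fun m => ae_of_all _ fun θ _ => by simp [hen])
      (ae_of_all _ fun θ _ => hc) intervalIntegrable_const
      (ae_of_all _ fun θ _ => (hF θ).mul_left _)
    refine h.unique ?_
    have h2 : ∀ m, ∫ θ in (-Real.pi)..Real.pi, (starRingEnd ℂ) (e n θ) * (c m * e m θ) =
        if m = n then 2 * Real.pi * c n else 0 := fun m => by
      simp only [mul_left_comm _ (c m)]
      rw [intervalIntegral.integral_const_mul, horth]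
      split_ifs with hmn
      · rw [hmn, mul_comm]
      · simp
    simp only [h2]
    exact hasSum_ite_eq n _
  have h := intervalIntegral.hasSum_integral_of_dominated_convergence (μ := volume)
    (a := -Real.pi) (b := Real.pi)
    (F := fun m θ => (starRingEnd ℂ) (F θ) * (c m * e m θ))
    (f := fun θ => (starRingEnd ℂ) (F θ) * F θ) (fun m _ => (∑' n, ‖c n‖) * ‖c m‖)
    (fun m => (Continuous.aestronglyMeasurable
      ((Complex.continuous_conj.comp hFc).mul (continuous_const.mul (hec m)))))
    (fun m => ae_of_all _ fun θ _ => by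
      simp only [norm_mul, RCLike.norm_conj, hen, mul_one]
      exact mul_le_mul_of_nonneg_right (hFb θ) (norm_nonneg _))
    (ae_of_all _ fun θ _ => hc.mul_left _) intervalIntegrable_const
    (ae_of_all _ fun θ _ => (hF θ).mul_left _)
  have h3 : ∀ m, ∫ θ in (-Real.pi)..Real.pi, (starRingEnd ℂ) (F θ) * (c m * e m θ) =
      ((2 * Real.pi * ‖c m‖ ^ 2 : ℝ) : ℂ) := fun m => by
    have h4 : ∀ θ, (starRingEnd ℂ) (F θ) * (c m * e m θ) =
        c m * (starRingEnd ℂ) ((starRingEnd ℂ) (e m θ) * F θ) := fun θ => by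
      simp
      ring
    simp only [h4]
    rw [intervalIntegral.integral_const_mul]
    have h5 := Complex.conjCLE.toContinuousLinearMap.intervalIntegral_comp_comm (μ := volume)
      (a := -Real.pi) (b := Real.pi) (f := fun θ => (starRingEnd ℂ) (e m θ) * F θ)
      (((Complex.continuous_conj.comp (hec m)).mul hFc).intervalIntegrable _ _)
    simp only [ContinuousLinearEquiv.coe_coe, Complex.conjCLE_apply] at h5
    rw [h5, hcoef]
    simp only [map_mul, Complex.conj_ofReal, map_ofNat]
    rw [mul_left_comm, Complex.mul_conj']
    push_cast
    ring
  have h6 : ∫ θ in (-Real.pi)..Real.pi, (starRingEnd ℂ) (F θ) * F θ =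
      ((∫ θ in (-Real.pi)..Real.pi, ‖F θ‖ ^ 2 : ℝ) : ℂ) := by
    rw [← intervalIntegral.integral_ofReal]
    refine intervalIntegral.integral_congr fun θ _ => ?_
    simp [Complex.conj_mul']
  simp only [h3, h6] at h
  exact_mod_cast h

theorem real_mul_exp_mem_ball {r : ℝ} (hr : r ∈ Set.Ioo (0:ℝ) 1) (θ : ℝ) :
    (r * Complex.exp (θ * Complex.I) : ℂ) ∈ Metric.ball (0:ℂ) 1 := by
  rw [mem_ball_zero_iff, norm_mul, Complex.norm_exp_ofReal_mul_I, Complex.norm_real, mul_one,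
    Real.norm_of_nonneg hr.1.le]
  exact hr.2

/-- The weighted Bergman norm of an analytic function in terms of its Taylor coefficients. -/
theorem lintegral_ball_sq_norm_eq_tsum {h : ℂ → ℂ} (hh : ContinuousOn h (Metric.ball 0 1))
    {c : ℕ → ℂ} (hc : ∀ u ∈ Metric.ball (0:ℂ) 1, HasSum (fun n : ℕ => c n * u ^ n) (h u))
    {b : ℝ} (hb : -1 < b) :
    ∫⁻ u in Metric.ball (0:ℂ) 1,
        ENNReal.ofReal (‖h u‖ ^ 2) * ENNReal.ofReal ((1 - ‖u‖ ^ 2) ^ b) =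
      ∑' n, ENNReal.ofReal (2 * Real.pi * (‖c n‖ ^ 2 *
        ∫ r in (0:ℝ)..1, r ^ (2 * n + 1) * (1 - r ^ 2) ^ b)) := by
  rw [lintegral_ball_mul_radial (F := fun u => ENNReal.ofReal (‖h u‖ ^ 2))
    (ENNReal.continuous_ofReal.comp_continuousOn (hh.norm.pow 2)) b]
  have hcirc : ∀ r ∈ Set.Ioo (0:ℝ) 1, ENNReal.ofReal (r * (1 - r ^ 2) ^ b) *
      ∫⁻ θ in Set.Ioo (-Real.pi) Real.pi,
        ENNReal.ofReal (‖h (r * Complex.exp (θ * Complex.I))‖ ^ 2) =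
      ∑' n, ENNReal.ofReal (2 * Real.pi * ‖c n‖ ^ 2 * (r ^ (2 * n + 1) * (1 - r ^ 2) ^ b)) := by
    intro r hr
    have h0 : 0 < 1 - r ^ 2 := by nlinarith [hr.1, hr.2]
    have hr0 := hr.1
    have hsum : Summable fun n => ‖c n * (r : ℂ) ^ n‖ := by
      have := (hc r (by simpa using real_mul_exp_mem_ball hr 0)).summable.norm
      simpa using this
    have hP := hasSum_integral_sq_norm hsum
      (F := fun θ => h (r * Complex.exp (θ * Complex.I))) fun θ => by
        have := hc _ (real_mul_exp_mem_ball hr θ)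
        simpa only [mul_pow, mul_assoc] using this
    have hcont : Continuous fun θ : ℝ => h (r * Complex.exp (θ * Complex.I)) :=
      hh.comp_continuous (by fun_prop) (real_mul_exp_mem_ball hr)
    rw [lintegral_Ioo_eq_ofReal_integral
      (φ := fun θ => ‖h (r * Complex.exp (θ * Complex.I))‖ ^ 2) (by linarith [Real.pi_pos])
      ((hcont.norm.pow 2).intervalIntegrable _ _) (fun _ _ => by positivity), ← hP.tsum_eq,
      ENNReal.ofReal_tsum_of_nonneg (fun n => by positivity) hP.summable, ← ENNReal.tsum_mul_left]
    refine tsum_congr fun n => ?_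
    rw [← ENNReal.ofReal_mul (by positivity)]
    congr 1
    rw [norm_mul, norm_pow, Complex.norm_real, Real.norm_of_nonneg hr0.le]
    ring
  rw [setLIntegral_congr_fun measurableSet_Ioo hcirc, lintegral_tsum fun n => by fun_prop]
  refine tsum_congr fun n => ?_
  rw [lintegral_Ioo_eq_ofReal_integral zero_le_one
    ((intervalIntegrable_pow_mul_one_sub_sq_rpow hb (2 * n)).const_mul _),
    intervalIntegral.integral_const_mul, mul_assoc]
  intro r hr
  have h0 : 0 < 1 - r ^ 2 := by nlinarith [hr.1, hr.2]
  have hr0 := hr.1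
  positivity

/-- A Littlewood–Paley inequality for weighted Bergman norms on the unit disc. -/
theorem lintegral_ball_sq_norm_le_deriv {σ : ℝ} (hσ : -1 < σ) {g : ℂ → ℂ}
    (hg : DifferentiableOn ℂ g (Metric.ball 0 1)) (hg0 : g 0 = 0) :
    ∫⁻ u in Metric.ball (0:ℂ) 1,
        ENNReal.ofReal (‖g u‖ ^ 2) * ENNReal.ofReal ((1 - ‖u‖ ^ 2) ^ σ) ≤
      ENNReal.ofReal ((σ + 3) / ((σ + 1) * (σ + 2))) * ∫⁻ u in Metric.ball (0:ℂ) 1,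
        ENNReal.ofReal (‖deriv g u‖ ^ 2) * ENNReal.ofReal ((1 - ‖u‖ ^ 2) ^ (σ + 2)) := by
  have hg' := hg.deriv Metric.isOpen_ball
  have s1 : 0 < σ + 1 := by linarith
  have s2 : 0 < σ + 2 := by linarith
  have s3 : 0 < σ + 3 := by linarith
  set a : ℕ → ℂ := fun n => (n.factorial : ℂ)⁻¹ * iteratedDeriv n g 0 with ha
  have hsum : ∀ u ∈ Metric.ball (0:ℂ) 1, HasSum (fun n : ℕ => a n * u ^ n) (g u) := by
    intro u hu
    refine (congrArg (HasSum · (g u)) (funext fun n => ?_)).mpr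
      (Complex.hasSum_taylorSeries_on_ball hg hu)
    simp [ha]
    ring
  have hsum' : ∀ u ∈ Metric.ball (0:ℂ) 1,
      HasSum (fun n : ℕ => ((n + 1 : ℝ) * a (n + 1)) * u ^ n) (deriv g u) := by
    intro u hu
    refine (congrArg (HasSum · (deriv g u)) (funext fun n => ?_)).mpr
      (Complex.hasSum_taylorSeries_on_ball hg' hu)
    have : (n : ℂ) + 1 ≠ 0 := Nat.cast_add_one_ne_zero n
    simp [ha, iteratedDeriv_succ', Nat.factorial_succ]
    field_simp
  rw [lintegral_ball_sq_norm_eq_tsum hg.continuousOn hsum hσ,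
    lintegral_ball_sq_norm_eq_tsum hg'.continuousOn hsum' (by linarith),
    tsum_eq_zero_add' ENNReal.summable, ← ENNReal.tsum_mul_left]
  have ha0 : a 0 = 0 := by simp [ha, hg0]
  simp only [ha0, norm_zero, zero_pow two_ne_zero, zero_mul, mul_zero, ENNReal.ofReal_zero,
    zero_add]
  refine ENNReal.tsum_le_tsum fun n => ?_
  rw [← ENNReal.ofReal_mul (by positivity)]
  refine ENNReal.ofReal_le_ofReal ?_
  have h := integral_pow_add_three_mul_one_sub_sq_rpow_le hσ n
  rw [show 2 * (n + 1) + 1 = 2 * n + 3 by ring, norm_mul (((n + 1 : ℝ)) : ℂ), Complex.norm_real,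
    Real.norm_of_nonneg (by positivity)]
  calc _ ≤ 2 * Real.pi * (‖a (n + 1)‖ ^ 2 * ((σ + 3) / ((σ + 1) * (σ + 2)) *
        ((n + 1) ^ 2 * ∫ r in (0:ℝ)..1, r ^ (2 * n + 1) * (1 - r ^ 2) ^ (σ + 2)))) := by gcongr
    _ = _ := by ring

/-- The mean value property of the real part of an analytic function, for radial weights. -/
theorem lintegral_ball_re_eq {σ : ℝ} (hσ : -1 < σ) {h : ℂ → ℂ}
    (hh : DifferentiableOn ℂ h (Metric.ball 0 1)) (h0 : ∀ u ∈ Metric.ball (0:ℂ) 1, 0 ≤ (h u).re) :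
    ∫⁻ u in Metric.ball (0:ℂ) 1,
        ENNReal.ofReal (h u).re * ENNReal.ofReal ((1 - ‖u‖ ^ 2) ^ σ) =
      ENNReal.ofReal (Real.pi / (σ + 1)) * ENNReal.ofReal (h 0).re := by
  rw [lintegral_ball_mul_radial (F := fun u => ENNReal.ofReal (h u).re)
    (ENNReal.continuous_ofReal.comp_continuousOn
      (Complex.continuous_re.comp_continuousOn hh.continuousOn)) σ]
  have hcirc : ∀ r ∈ Set.Ioo (0:ℝ) 1, ENNReal.ofReal (r * (1 - r ^ 2) ^ σ) *
      ∫⁻ θ in Set.Ioo (-Real.pi) Real.pi,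
        ENNReal.ofReal (h (r * Complex.exp (θ * Complex.I))).re =
      ENNReal.ofReal (r * (1 - r ^ 2) ^ σ) * ENNReal.ofReal (2 * Real.pi * (h 0).re) := by
    intro r hr
    have hcont : Continuous fun θ : ℝ => h (r * Complex.exp (θ * Complex.I)) :=
      hh.continuousOn.comp_continuous (by fun_prop) (real_mul_exp_mem_ball hr)
    have hsub : Metric.closedBall (0:ℂ) |r| ⊆ Metric.ball 0 1 :=
      Metric.closedBall_subset_ball (by rw [abs_of_pos hr.1]; exact hr.2)
    have hmean : Real.circleAverage h 0 r = h 0 :=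
      ((hh.mono hsub).diffContOnCl_ball subset_rfl).circleAverage
    rw [Real.circleAverage_eq_integral_add (-Real.pi),
      intervalIntegral.integral_comp_add_right (fun θ => h (circleMap 0 r θ))] at hmean
    simp only [circleMap, zero_add, show 2 * Real.pi + -Real.pi = Real.pi by ring] at hmean
    have hre := Complex.reCLM.intervalIntegral_comp_comm (μ := volume)
      (hcont.intervalIntegrable (-Real.pi) Real.pi)
    simp only [Complex.reCLM_apply] at hre
    rw [lintegral_Ioo_eq_ofReal_integral
      (φ := fun θ => (h (r * Complex.exp (θ * Complex.I))).re) (by linarith [Real.pi_pos])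
      ((Complex.continuous_re.comp hcont).intervalIntegrable _ _)
      (fun θ _ => h0 _ (real_mul_exp_mem_ball hr θ)), hre, ← hmean, Complex.smul_re, smul_eq_mul,
      mul_inv_cancel_left₀ (by positivity)]
  have s1 : 0 < σ + 1 := by linarith
  rw [setLIntegral_congr_fun measurableSet_Ioo hcirc, lintegral_mul_const _ (by fun_prop),
    lintegral_Ioo_eq_ofReal_integral zero_le_one (intervalIntegrable_mul_one_sub_sq_rpow hσ),
    integral_mul_one_sub_sq_rpow hσ, ← ENNReal.ofReal_mul (by positivity),
    ← ENNReal.ofReal_mul (by positivity)]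
  · congr 1
    field_simp
  · intro r hr
    have h0 : 0 < 1 - r ^ 2 := by nlinarith [hr.1, hr.2]
    have hr0 := hr.1
    positivity

theorem measurable_discInvolution (a : ℂ) : Measurable (discInvolution a) := by
  unfold discInvolution
  fun_prop

theorem discInvolution_zero (a : ℂ) : discInvolution a 0 = a := by simp [discInvolution]

theorem differentiableOn_discInvolution {a : ℂ} (ha : a ∈ Metric.ball (0:ℂ) 1) :
    DifferentiableOn ℂ (discInvolution a) (Metric.ball 0 1) := fun _ hu =>
  (hasDerivAt_discInvolution ha hu).differentiableAt.differentiableWithinAt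

theorem sub_ne_zero_of_mem_sphere_of_mem_ball {ζ z : ℂ} (hζ : ζ ∈ Metric.sphere (0:ℂ) 1)
    (hz : z ∈ Metric.ball (0:ℂ) 1) : ζ - z ≠ 0 := by
  intro h
  rw [mem_sphere_zero_iff_norm] at hζ
  rw [mem_ball_zero_iff, ← sub_eq_zero.mp h, hζ] at hz
  exact lt_irrefl _ hz

theorem re_add_div_sub_eq {ζ z : ℂ} (hζ : ζ ∈ Metric.sphere (0:ℂ) 1) :
    ((ζ + z) / (ζ - z)).re = (1 - ‖z‖ ^ 2) / ‖ζ - z‖ ^ 2 := by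
  have h1 : ‖ζ‖ ^ 2 = 1 := by rw [mem_sphere_zero_iff_norm.mp hζ, one_pow]
  rw [Complex.div_re, ← add_div, ← h1]
  simp only [← Complex.normSq_eq_norm_sq]
  congr 1
  simp only [Complex.normSq_apply, Complex.add_re, Complex.add_im, Complex.sub_re, Complex.sub_im]
  ring

theorem ofReal_poissonInt {μ : Measure ℂ} [IsFiniteMeasure μ]
    (hμ : ∀ᵐ ζ ∂μ, ζ ∈ Metric.sphere (0:ℂ) 1) {z : ℂ} (hz : z ∈ Metric.ball (0:ℂ) 1) :
    ENNReal.ofReal (poissonInt μ z) =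
      ∫⁻ ζ, ENNReal.ofReal ((2 * Real.pi)⁻¹ * ((1 - ‖z‖ ^ 2) / ‖ζ - z‖ ^ 2)) ∂μ := by
  have h0 := one_sub_sq_norm_pos hz
  have hz' : ‖z‖ < 1 := mem_ball_zero_iff.mp hz
  rw [poissonInt, ← integral_const_mul, ofReal_integral_eq_lintegral_ofReal]
  · refine Integrable.const_mul ?_ _
    refine Integrable.of_bound (C := (1 - ‖z‖ ^ 2) / (1 - ‖z‖) ^ 2)
      (Measurable.aestronglyMeasurable (by fun_prop)) ?_
    filter_upwards [hμ] with ζ hζ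
    have h1 : 1 - ‖z‖ ≤ ‖ζ - z‖ := by
      rw [← mem_sphere_zero_iff_norm.mp hζ]
      exact norm_sub_norm_le ζ z
    have h2 : 0 < 1 - ‖z‖ := by linarith
    rw [Real.norm_of_nonneg (by positivity)]
    gcongr
  · exact ae_of_all _ fun ζ => by positivity

theorem measurable_poissonInt (μ : Measure ℂ) [IsFiniteMeasure μ] : Measurable (poissonInt μ) := by
  have h : Measurable fun p : ℂ × ℂ => (1 - ‖p.1‖ ^ 2) / ‖p.2 - p.1‖ ^ 2 := by fun_prop
  exact h.stronglyMeasurable.integral_prod_right.measurable.const_mul _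

/-- The weighted Möbius-invariant mean value property of Poisson integrals. -/
theorem lintegral_poissonInt_comp_discInvolution {σ : ℝ} (hσ : -1 < σ) {μ : Measure ℂ}
    [IsFiniteMeasure μ] (hμ : ∀ᵐ ζ ∂μ, ζ ∈ Metric.sphere (0:ℂ) 1) {w : ℂ}
    (hw : w ∈ Metric.ball (0:ℂ) 1) :
    ∫⁻ u in Metric.ball (0:ℂ) 1, ENNReal.ofReal (poissonInt μ (discInvolution w u)) *
        ENNReal.ofReal ((1 - ‖u‖ ^ 2) ^ σ) =
      ENNReal.ofReal (Real.pi / (σ + 1)) * ENNReal.ofReal (poissonInt μ w) := by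
  have hφ := measurable_discInvolution w
  have hpi : (0:ℝ) ≤ (2 * Real.pi)⁻¹ := by positivity
  calc _ = ∫⁻ u in Metric.ball (0:ℂ) 1, ∫⁻ ζ, ENNReal.ofReal ((2 * Real.pi)⁻¹ *
          ((1 - ‖discInvolution w u‖ ^ 2) / ‖ζ - discInvolution w u‖ ^ 2)) *
            ENNReal.ofReal ((1 - ‖u‖ ^ 2) ^ σ) ∂μ := by
        refine setLIntegral_congr_fun measurableSet_ball fun u hu => ?_
        simp only [ofReal_poissonInt hμ (discInvolution_mem_ball hw hu)]
        rw [lintegral_mul_const _ (by fun_prop)]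
    _ = ∫⁻ ζ, (∫⁻ u in Metric.ball (0:ℂ) 1, ENNReal.ofReal ((2 * Real.pi)⁻¹ *
          ((1 - ‖discInvolution w u‖ ^ 2) / ‖ζ - discInvolution w u‖ ^ 2)) *
            ENNReal.ofReal ((1 - ‖u‖ ^ 2) ^ σ)) ∂μ := by
        refine lintegral_lintegral_swap (Measurable.aemeasurable ?_)
        fun_prop
    _ = ∫⁻ ζ, ENNReal.ofReal (Real.pi / (σ + 1)) *
          ENNReal.ofReal ((2 * Real.pi)⁻¹ * ((1 - ‖w‖ ^ 2) / ‖ζ - w‖ ^ 2)) ∂μ := by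
        refine lintegral_congr_ae ?_
        filter_upwards [hμ] with ζ hζ
        have hmem : ∀ u ∈ Metric.ball (0:ℂ) 1, ζ - discInvolution w u ≠ 0 := fun u hu =>
          sub_ne_zero_of_mem_sphere_of_mem_ball hζ (discInvolution_mem_ball hw hu)
        have hd := differentiableOn_discInvolution hw
        have h := lintegral_ball_re_eq hσ
          (h := fun u => (ζ + discInvolution w u) / (ζ - discInvolution w u))
          ((hd.const_add ζ).div (hd.const_sub ζ) hmem) (fun u hu => by
            rw [re_add_div_sub_eq hζ]
            have := one_sub_sq_norm_pos (discInvolution_mem_ball hw hu)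
            positivity)
        simp only [re_add_div_sub_eq hζ, discInvolution_zero] at h
        simp only [ENNReal.ofReal_mul hpi, mul_assoc]
        rw [lintegral_const_mul _ (by fun_prop), h]
        ring
    _ = _ := by rw [lintegral_const_mul _ (by fun_prop), ofReal_poissonInt hμ hw]

theorem norm_one_sub_conj_mul_comm (z w : ℂ) :
    ‖1 - (starRingEnd ℂ) z * w‖ = ‖1 - (starRingEnd ℂ) w * z‖ := by
  rw [← RCLike.norm_conj (1 - (starRingEnd ℂ) z * w)]
  simp [mul_comm]

/-- A Möbius-invariant Littlewood–Paley inequality centred at an arbitrary point of the disc. -/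
theorem lintegral_ball_sq_norm_sub_le {σ : ℝ} (hσ : -1 < σ) {f : ℂ → ℂ}
    (hf : DifferentiableOn ℂ f (Metric.ball 0 1)) {z : ℂ} (hz : z ∈ Metric.ball (0:ℂ) 1) :
    ∫⁻ w in Metric.ball (0:ℂ) 1, ENNReal.ofReal (‖f z - f w‖ ^ 2) * ENNReal.ofReal
        ((1 - ‖w‖ ^ 2) ^ σ * (1 - ‖z‖ ^ 2) ^ (σ + 2) /
          ‖1 - (starRingEnd ℂ) z * w‖ ^ (4 + 2 * σ)) ≤
      ENNReal.ofReal ((σ + 3) / ((σ + 1) * (σ + 2))) * ∫⁻ w in Metric.ball (0:ℂ) 1,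
        ENNReal.ofReal (‖deriv f w‖ ^ 2 * (1 - ‖w‖ ^ 2) ^ 2) * ENNReal.ofReal
          ((1 - ‖w‖ ^ 2) ^ σ * (1 - ‖z‖ ^ 2) ^ (σ + 2) /
            ‖1 - (starRingEnd ℂ) z * w‖ ^ (4 + 2 * σ)) := by
  rw [lintegral_ball_comp_discInvolution hz σ (fun w => ENNReal.ofReal (‖f z - f w‖ ^ 2)),
    lintegral_ball_comp_discInvolution hz σ
      (fun w => ENNReal.ofReal (‖deriv f w‖ ^ 2 * (1 - ‖w‖ ^ 2) ^ 2))]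
  have hg : DifferentiableOn ℂ (fun u => f z - f (discInvolution z u)) (Metric.ball 0 1) :=
    (hf.comp (differentiableOn_discInvolution hz)
      fun u hu => discInvolution_mem_ball hz hu).const_sub (f z)
  refine (lintegral_ball_sq_norm_le_deriv hσ hg (by simp [discInvolution_zero])).trans_eq ?_
  congr 1
  refine setLIntegral_congr_fun measurableSet_ball fun u hu => ?_
  have hU := one_sub_sq_norm_pos hu
  have hZ := one_sub_sq_norm_pos hz
  have hfd := (hf.differentiableAt
    (Metric.isOpen_ball.mem_nhds (discInvolution_mem_ball hz hu))).hasDerivAt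
  have hd := ((hfd.comp u (hasDerivAt_discInvolution hz hu)).const_sub (f z)).deriv
  simp only [Function.comp_def] at hd
  simp only [hd, one_sub_sq_norm_discInvolution hz hu]
  rw [← ENNReal.ofReal_mul (by positivity), ← ENNReal.ofReal_mul (by positivity)]
  congr 1
  have hp : (1 - ‖u‖ ^ 2) ^ (σ + 2) = (1 - ‖u‖ ^ 2) ^ σ * (1 - ‖u‖ ^ 2) ^ 2 := by
    rw [Real.rpow_add hU]
    norm_cast
  rw [hp, norm_neg, norm_mul, norm_div, norm_neg, Complex.norm_real, Real.norm_of_nonneg hZ.le,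
    norm_pow]
  ring

theorem stmt4 (σ : ℝ) (hσ : -1 < σ) :
    ∃ C : ℝ, 0 < C ∧
      ∀ μ : Measure ℂ, IsFiniteMeasure μ → μ ((Metric.sphere (0:ℂ) 1)ᶜ) = 0 →
      ∀ f : ℂ → ℂ, DifferentiableOn ℂ f (Metric.ball (0:ℂ) 1) →
        (∫⁻ w in Metric.ball (0:ℂ) 1, ∫⁻ z in Metric.ball (0:ℂ) 1,
            ENNReal.ofReal (‖f z - f w‖ ^ 2 / ‖1 - (starRingEnd ℂ) z * w‖ ^ (4 + 2 * σ)
              * (poissonInt μ z * ((1 - ‖z‖ ^ 2) ^ σ * (1 - ‖w‖ ^ 2) ^ σ))))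
          ≤ ENNReal.ofReal C *
            ∫⁻ w in Metric.ball (0:ℂ) 1,
              ENNReal.ofReal (‖deriv f w‖ ^ 2 * poissonInt μ w) := by
  have s1 : 0 < σ + 1 := by linarith
  have s2 : 0 < σ + 2 := by linarith
  have s3 : 0 < σ + 3 := by linarith
  refine ⟨(σ + 3) / ((σ + 1) * (σ + 2)) * (Real.pi / (σ + 1)), by positivity, ?_⟩
  intro μ hμfin hμ0 f hf
  have hμ : ∀ᵐ ζ ∂μ, ζ ∈ Metric.sphere (0:ℂ) 1 := hμ0
  have hP := measurable_poissonInt μ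
  have hf' := measurable_deriv f
  have hfm : AEMeasurable f (volume.restrict (Metric.ball (0:ℂ) 1)) :=
    hf.continuousOn.aemeasurable measurableSet_ball
  have hfm1 : AEMeasurable (fun p : ℂ × ℂ => f p.1) ((volume.restrict (Metric.ball (0:ℂ) 1)).prod
      (volume.restrict (Metric.ball (0:ℂ) 1))) := hfm.comp_fst
  have hfm2 : AEMeasurable (fun p : ℂ × ℂ => f p.2) ((volume.restrict (Metric.ball (0:ℂ) 1)).prod
      (volume.restrict (Metric.ball (0:ℂ) 1))) := hfm.comp_snd
  set k : ℂ → ℂ → ENNReal := fun z w => ENNReal.ofReal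
    ((1 - ‖w‖ ^ 2) ^ σ * (1 - ‖z‖ ^ 2) ^ (σ + 2) /
      ‖1 - (starRingEnd ℂ) z * w‖ ^ (4 + 2 * σ)) with hk
  set q : ℂ → ENNReal := fun z => ENNReal.ofReal (((1 - ‖z‖ ^ 2) ^ 2)⁻¹) with hq
  have hkm : Measurable (fun p : ℂ × ℂ => k p.1 p.2) := by
    simp only [hk]
    fun_prop
  have hqm : Measurable q := by
    simp only [hq]
    fun_prop
  have hPpos : ∀ z ∈ Metric.ball (0:ℂ) 1, 0 ≤ poissonInt μ z := fun z hz => by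
    have := one_sub_sq_norm_pos hz
    exact mul_nonneg (by positivity) (integral_nonneg fun ζ => by positivity)
  have hpow : ∀ z ∈ Metric.ball (0:ℂ) 1,
      (1 - ‖z‖ ^ 2) ^ (σ + 2) = (1 - ‖z‖ ^ 2) ^ σ * (1 - ‖z‖ ^ 2) ^ 2 := fun z hz => by
    rw [Real.rpow_add (one_sub_sq_norm_pos hz)]
    norm_cast
  have hkpos : ∀ z ∈ Metric.ball (0:ℂ) 1, ∀ w ∈ Metric.ball (0:ℂ) 1,
      0 < ‖1 - (starRingEnd ℂ) z * w‖ := fun z hz w hw =>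
    norm_pos_iff.mpr (one_sub_conj_mul_ne_zero hz hw)
  have hsymm : ∀ z ∈ Metric.ball (0:ℂ) 1, ∀ w ∈ Metric.ball (0:ℂ) 1,
      ENNReal.ofReal ((1 - ‖w‖ ^ 2) ^ 2) * (q z * k z w) = k w z := fun z hz w hw => by
    have hZ := one_sub_sq_norm_pos hz
    have hW := one_sub_sq_norm_pos hw
    have hD := hkpos z hz w hw
    simp only [hk, hq]
    rw [← ENNReal.ofReal_mul (by positivity), ← ENNReal.ofReal_mul (by positivity),
      hpow z hz, hpow w hw, norm_one_sub_conj_mul_comm w z]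
    congr 1
    field_simp
  calc _ = ∫⁻ z in Metric.ball (0:ℂ) 1, ∫⁻ w in Metric.ball (0:ℂ) 1,
            ENNReal.ofReal (‖f z - f w‖ ^ 2 / ‖1 - (starRingEnd ℂ) z * w‖ ^ (4 + 2 * σ)
              * (poissonInt μ z * ((1 - ‖z‖ ^ 2) ^ σ * (1 - ‖w‖ ^ 2) ^ σ))) := by
        refine lintegral_lintegral_swap ?_
        fun_prop
    _ = ∫⁻ z in Metric.ball (0:ℂ) 1, ENNReal.ofReal (poissonInt μ z) * q z *
          ∫⁻ w in Metric.ball (0:ℂ) 1, ENNReal.ofReal (‖f z - f w‖ ^ 2) * k z w := by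
        refine setLIntegral_congr_fun measurableSet_ball fun z hz => ?_
        rw [← lintegral_const_mul' _ _
          (ENNReal.mul_ne_top ENNReal.ofReal_ne_top ENNReal.ofReal_ne_top)]
        refine setLIntegral_congr_fun measurableSet_ball fun w hw => ?_
        have hZ := one_sub_sq_norm_pos hz
        have hW := one_sub_sq_norm_pos hw
        have hD := hkpos z hz w hw
        have hPz := hPpos z hz
        simp only [hk]
        rw [← ENNReal.ofReal_mul (by positivity), ← ENNReal.ofReal_mul (by positivity),
          ← ENNReal.ofReal_mul (by positivity), hpow z hz]
        congr 1
        field_simp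
    _ ≤ ∫⁻ z in Metric.ball (0:ℂ) 1, ENNReal.ofReal (poissonInt μ z) * q z *
          (ENNReal.ofReal ((σ + 3) / ((σ + 1) * (σ + 2))) * ∫⁻ w in Metric.ball (0:ℂ) 1,
            ENNReal.ofReal (‖deriv f w‖ ^ 2 * (1 - ‖w‖ ^ 2) ^ 2) * k z w) :=
        setLIntegral_mono' measurableSet_ball fun z hz =>
          mul_le_mul_right (lintegral_ball_sq_norm_sub_le hσ hf hz) _
    _ = ENNReal.ofReal ((σ + 3) / ((σ + 1) * (σ + 2))) * ∫⁻ z in Metric.ball (0:ℂ) 1,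
          ∫⁻ w in Metric.ball (0:ℂ) 1, ENNReal.ofReal (poissonInt μ z) * q z *
            (ENNReal.ofReal (‖deriv f w‖ ^ 2 * (1 - ‖w‖ ^ 2) ^ 2) * k z w) := by
        rw [← lintegral_const_mul' _ _ ENNReal.ofReal_ne_top]
        refine setLIntegral_congr_fun measurableSet_ball fun z hz => ?_
        rw [lintegral_const_mul' _ _
          (ENNReal.mul_ne_top ENNReal.ofReal_ne_top ENNReal.ofReal_ne_top)]
        ring
    _ = ENNReal.ofReal ((σ + 3) / ((σ + 1) * (σ + 2))) * ∫⁻ w in Metric.ball (0:ℂ) 1,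
          ∫⁻ z in Metric.ball (0:ℂ) 1, ENNReal.ofReal (poissonInt μ z) * q z *
            (ENNReal.ofReal (‖deriv f w‖ ^ 2 * (1 - ‖w‖ ^ 2) ^ 2) * k z w) := by
        congr 1
        refine lintegral_lintegral_swap (Measurable.aemeasurable ?_)
        fun_prop
    _ = ENNReal.ofReal ((σ + 3) / ((σ + 1) * (σ + 2))) * ∫⁻ w in Metric.ball (0:ℂ) 1,
          ENNReal.ofReal (Real.pi / (σ + 1)) *
            ENNReal.ofReal (‖deriv f w‖ ^ 2 * poissonInt μ w) := by
        congr 1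
        refine setLIntegral_congr_fun measurableSet_ball fun w hw => ?_
        rw [ENNReal.ofReal_mul (q := poissonInt μ w) (by positivity), mul_left_comm,
          ← lintegral_poissonInt_comp_discInvolution hσ hμ hw,
          ← lintegral_ball_comp_discInvolution hw σ (fun z => ENNReal.ofReal (poissonInt μ z)),
          ← lintegral_const_mul' _ _ ENNReal.ofReal_ne_top]
        refine setLIntegral_congr_fun measurableSet_ball fun z hz => ?_
        have h := hsymm z hz w hw
        simp only [hk] at h ⊢
        rw [← h, ENNReal.ofReal_mul (by positivity)]
        ring
    _ = _ := by
        rw [lintegral_const_mul' _ _ ENNReal.ofReal_ne_top, ENNReal.ofReal_mul (by positivity),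
          mul_assoc]
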